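/- For any integers a ≤ b, the Q(q^{1/2})-linear map Â[b] ⊗ Â[b−1] ⊗ ⋯ ⊗ Â[a+1] ⊗ Â[a] → Â[a,b] given by x_b ⊗ x_{b−1} ⊗ ⋯ ⊗ x_a ↦ x_b x_{b−1} ⋯ x_a (multiplication in Â) is an isomorphism of vector spaces. -/

import Mathlib

/- Common setting: a symmetrizable generalized Cartan matrix, the field
`𝕂 = ℚ(q^{1/2})` (with `sqv = q^{1/2}` and `q = qh = sqv²`), quantum integers, the bosonic
extension `hA A` presented by the `q`-Serre relations and the bosonic commutation
relations, its weight spaces and distinguished subalgebras, and the root-lattice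
pairing. -/

set_option maxHeartbeats 1000000
set_option synthInstance.maxHeartbeats 400000

noncomputable section

structure GCM (I : Type) where
  c : I → I → ℤ
  d : I → ℤ
  d_pos : ∀ i, 0 < d i
  diag : ∀ i, c i i = 2
  offdiag : ∀ i j, i ≠ j → c i j ≤ 0
  dsymm : ∀ i j, d i * c i j = d j * c j i

abbrev 𝕂 : Type := RatFunc ℚ

/-- The square root `q^{1/2}` of `q`. -/
def sqv : 𝕂 := RatFunc.X

/-- The indeterminate `q = (q^{1/2})²`. -/
def qh : 𝕂 := sqv ^ 2

def qNum (t : 𝕂) (n : ℕ) : 𝕂 := (t ^ n - t⁻¹ ^ n) / (t - t⁻¹)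

def qFact (t : 𝕂) (n : ℕ) : 𝕂 := ∏ k ∈ Finset.range n, qNum t (k + 1)

def qBinom (t : 𝕂) (m k : ℕ) : 𝕂 := qFact t m / (qFact t k * qFact t (m - k))

variable {I : Type} [DecidableEq I]

/-- `q_i = q^{d_i}`. -/
def qd (A : GCM I) (i : I) : 𝕂 := qh ^ A.d i

/-- `ζ_i = 1 - q_i²`. -/
def zi (A : GCM I) (i : I) : 𝕂 := 1 - qd A i ^ 2

/-- The `q`-Serre element `Σ_{k=0}^{b_{ij}} (-1)^k [b_{ij} choose k]_{q_i} a^k b a^{b_{ij}-k}`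
for elements `a, b` of any `𝕂`-algebra, where `b_{ij} = 1 - c_{ij}`. -/
def serreIn {R : Type} [Ring R] [Algebra 𝕂 R] (A : GCM I) (i j : I) (a b : R) : R :=
  ∑ k ∈ Finset.range ((1 - A.c i j).toNat + 1),
    ((-1 : 𝕂) ^ k * qBinom (qd A i) ((1 - A.c i j).toNat) k) •
      (a ^ k * b * a ^ ((1 - A.c i j).toNat - k))

/-- The defining relations of the bosonic extension: (a) for each `p`, the `q`-Serre
relations among the `f_{i,p}`; (b) for `m < p`,
`f_{i,m} f_{j,p} = q^{(-1)^{p-m+1}(α_i,α_j)} f_{j,p} f_{i,m} + δ_{(j,p),(i,m+1)}(1-q_i²)`. -/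
inductive hARel (A : GCM I) : FreeAlgebra 𝕂 (I × ℤ) → FreeAlgebra 𝕂 (I × ℤ) → Prop
  | serre (i j : I) (p : ℤ) (h : i ≠ j) :
      hARel A (serreIn A i j (FreeAlgebra.ι 𝕂 (i, p)) (FreeAlgebra.ι 𝕂 (j, p))) 0
  | comm (i j : I) (m p : ℤ) (h : m < p) :
      hARel A (FreeAlgebra.ι 𝕂 (i, m) * FreeAlgebra.ι 𝕂 (j, p))
        (qh ^ (((p - m + 1).negOnePow : ℤ) * (A.d i * A.c i j)) •
            (FreeAlgebra.ι 𝕂 (j, p) * FreeAlgebra.ι 𝕂 (i, m))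
          + if j = i ∧ p = m + 1 then ((1 : 𝕂) - qd A i ^ 2) • 1 else 0)

/-- The bosonic extension `Â` associated with the generalized Cartan matrix. -/
abbrev hA (A : GCM I) : Type := RingQuot (hARel A)

/-- The generator `f_{i,p}` of the bosonic extension. -/
def ff (A : GCM I) (i : I) (p : ℤ) : hA A :=
  RingQuot.mkAlgHom 𝕂 (hARel A) (FreeAlgebra.ι 𝕂 (i, p))

/-- The symmetric bilinear pairing on the root lattice, `(α_i, α_j) = d_i c_{ij}`. -/
def ip (A : GCM I) (β γ : I →₀ ℤ) : ℤ :=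
  β.sum fun i a => γ.sum fun j b => a * b * (A.d i * A.c i j)

/-- `α_{i,m} = (-1)^m α_i` as an element of the root lattice. -/
def aim (i : I) (m : ℤ) : I →₀ ℤ := Finsupp.single i ((m.negOnePow : ℤ))

/-- The weight space of weight `β` of `Â`, where `wt (f_{i,p}) = (-1)^{p+1} α_i`. -/
def hAwt (A : GCM I) (β : I →₀ ℤ) : Submodule 𝕂 (hA A) :=
  Submodule.span 𝕂 {x | ∃ l : List (I × ℤ),
    (l.map fun p => Finsupp.single p.1 (((p.2 + 1).negOnePow : ℤ))).sum = β ∧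
    x = (l.map fun p => ff A p.1 p.2).prod}

/-- The subalgebra `Â[a,b]` generated by `{f_{i,k} | a ≤ k ≤ b}`. -/
def hAband (A : GCM I) (a b : ℤ) : Subalgebra 𝕂 (hA A) :=
  Algebra.adjoin 𝕂 {x | ∃ i k, a ≤ k ∧ k ≤ b ∧ x = ff A i k}

/-- The subalgebra `Â[m]`. -/
def hAk (A : GCM I) (m : ℤ) : Subalgebra 𝕂 (hA A) := hAband A m m

/-- The subalgebra `Â_{≥ m}`. -/
def hAge (A : GCM I) (m : ℤ) : Subalgebra 𝕂 (hA A) :=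
  Algebra.adjoin 𝕂 {x | ∃ i k, m ≤ k ∧ x = ff A i k}

/-- The subalgebra `Â_{≤ m}`. -/
def hAle (A : GCM I) (m : ℤ) : Subalgebra 𝕂 (hA A) :=
  Algebra.adjoin 𝕂 {x | ∃ i k, k ≤ m ∧ x = ff A i k}

/-- The subalgebra `Â_{> m}`. -/
def hAgt (A : GCM I) (m : ℤ) : Subalgebra 𝕂 (hA A) := hAge A (m + 1)

/-- The subalgebra `Â_{< m}`. -/
def hAlt (A : GCM I) (m : ℤ) : Subalgebra 𝕂 (hA A) := hAle A (m - 1)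

/-- The multiplication map
`Â[b] ⊗ Â[b-1] ⊗ ⋯ ⊗ Â[a] → Â`, `x_b ⊗ ⋯ ⊗ x_a ↦ x_b x_{b-1} ⋯ x_a`
(the `k`-th tensor factor, `k : Fin (b+1-a)`, is `Â[b-k]`, so factors appear in
decreasing order of the index). -/
def mulMap (A : GCM I) (a b : ℤ) :
    PiTensorProduct 𝕂
        (fun k : Fin (b + 1 - a).toNat =>
          ↥(Subalgebra.toSubmodule (hAk A (b - (k : ℕ))))) →ₗ[𝕂] hA A :=
  PiTensorProduct.lift
    ((MultilinearMap.mkPiAlgebraFin 𝕂 ((b + 1 - a).toNat) (hA A)).compLinearMap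
      (fun k => (Subalgebra.toSubmodule (hAk A (b - (k : ℕ)))).subtype))

set_option linter.unusedSectionVars false

theorem qNum_inv (t : 𝕂) (n : ℕ) : qNum t⁻¹ n = qNum t n := by
  unfold qNum
  rw [inv_inv, ← neg_sub (t ^ n), ← neg_sub t, neg_div_neg_eq]

theorem qBinom_inv (t : 𝕂) (m k : ℕ) : qBinom t⁻¹ m k = qBinom t m k := by
  simp only [qBinom, qFact, qNum_inv]

theorem qFact_succ (t : 𝕂) (n : ℕ) : qFact t (n + 1) = qFact t n * qNum t (n + 1) :=
  Finset.prod_range_succ _ _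

/-- `t` is generic when all positive quantum integers at `t` are nonzero. -/
structure IsGeneric (t : 𝕂) : Prop where
  ne_zero : t ≠ 0
  sub_ne_zero : t - t⁻¹ ≠ 0
  qNum_ne_zero : ∀ n, qNum t (n + 1) ≠ 0

namespace IsGeneric

variable {t : 𝕂}

theorem inv (ht : IsGeneric t) : IsGeneric t⁻¹ where
  ne_zero := inv_ne_zero ht.ne_zero
  sub_ne_zero := by
    rw [inv_inv, ← neg_sub]
    exact neg_ne_zero.mpr ht.sub_ne_zero
  qNum_ne_zero n := by
    rw [qNum_inv]
    exact ht.qNum_ne_zero n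

theorem qFact_ne_zero (ht : IsGeneric t) (n : ℕ) : qFact t n ≠ 0 :=
  Finset.prod_ne_zero_iff.mpr fun k _ => ht.qNum_ne_zero k

theorem qBinom_zero (ht : IsGeneric t) (n : ℕ) : qBinom t n 0 = 1 := by
  have := ht.qFact_ne_zero n
  simp [qBinom, show qFact t 0 = 1 from rfl, this]

theorem qBinom_self (ht : IsGeneric t) (n : ℕ) : qBinom t n n = 1 := by
  have := ht.qFact_ne_zero n
  simp [qBinom, show qFact t 0 = 1 from rfl, this]

/-- `[k + m + 1 choose k + 1] [k + 1] = [k + m + 1 choose k] [m + 1]`. -/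
theorem qBinom_succ_mul (ht : IsGeneric t) (k m : ℕ) :
    qBinom t (k + m + 1) (k + 1) * qNum t (k + 1) =
      qBinom t (k + m + 1) k * qNum t (m + 1) := by
  have h1 := ht.qFact_ne_zero k
  have h2 := ht.qFact_ne_zero m
  have h3 := ht.qNum_ne_zero k
  have h4 := ht.qNum_ne_zero m
  rw [qBinom, qBinom, show k + m + 1 - (k + 1) = m by omega,
    show k + m + 1 - k = m + 1 by omega, qFact_succ t k, qFact_succ t m]
  field_simp

theorem qNum_add (ht : IsGeneric t) (k m : ℕ) :
    qNum t (k + m) = t⁻¹ ^ k * qNum t m + t ^ m * qNum t k := by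
  have h := ht.ne_zero
  unfold qNum
  rw [mul_div_assoc', mul_div_assoc', ← add_div]
  congr 1
  have h1 : t ^ k * t⁻¹ ^ k = 1 := by rw [← mul_pow, mul_inv_cancel₀ h, one_pow]
  rw [pow_add, pow_add]
  linear_combination (0 : 𝕂) * h1

/-- A Pascal identity for quantum binomial coefficients. -/
theorem qBinom_pascal (ht : IsGeneric t) (k m : ℕ) :
    qBinom t (k + m + 2) (k + 1) =
      t⁻¹ ^ (k + 1) * qBinom t (k + m + 1) (k + 1) + t ^ (m + 1) * qBinom t (k + m + 1) k := by
  have h1 := ht.qFact_ne_zero k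
  have h2 := ht.qFact_ne_zero m
  have h3 := ht.qNum_ne_zero k
  have h4 := ht.qNum_ne_zero m
  have h5 := ht.qNum_add (k + 1) (m + 1)
  rw [qBinom, qBinom, qBinom, show k + m + 2 - (k + 1) = m + 1 by omega,
    show k + m + 1 - (k + 1) = m by omega,
    show k + m + 1 - k = m + 1 by omega, show k + m + 2 = k + m + 1 + 1 by omega,
    qFact_succ t k, qFact_succ t m, qFact_succ t (k + m + 1),
    show k + m + 1 + 1 = k + 1 + (m + 1) by omega, h5]
  generalize t⁻¹ ^ (k + 1) = r
  field_simp

theorem alternating_sum_qBinom_partial (ht : IsGeneric t) (b n : ℕ) (hn : n ≤ b) :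
    ∑ k ∈ Finset.range (n + 1), (-1 : 𝕂) ^ k * qBinom t (b + 1) k * (t⁻¹ ^ b) ^ k =
      (-1) ^ n * qBinom t b n * (t⁻¹ ^ (b + 1)) ^ n := by
  induction n with
  | zero => simp [ht.qBinom_zero]
  | succ n ih =>
    obtain ⟨m, rfl⟩ := Nat.exists_eq_add_of_le hn
    rw [Finset.sum_range_succ, ih (by omega), show n + 1 + m + 1 = n + m + 2 by omega,
      ht.qBinom_pascal, show n + 1 + m = n + m + 1 by omega]
    have h1 : t * t⁻¹ = 1 := mul_inv_cancel₀ ht.ne_zero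
    have h2 : t ^ (m + 1) * (t⁻¹ ^ (n + m + 1)) ^ (n + 1) = (t⁻¹ ^ (n + m + 1 + 1)) ^ n := by
      rw [← pow_mul, ← pow_mul, show (n + m + 1) * (n + 1) = (m + 1) + (n + m + 1 + 1) * n by ring,
        pow_add t⁻¹, ← mul_assoc, ← mul_pow, h1, one_pow, one_mul]
    rw [show n + m + 2 = n + m + 1 + 1 by omega]
    linear_combination (-1 : 𝕂) ^ (n + 1) * qBinom t (n + m + 1) n * h2

theorem alternating_sum_qBinom (ht : IsGeneric t) (b : ℕ) :
    ∑ k ∈ Finset.range (b + 2), (-1 : 𝕂) ^ k * qBinom t (b + 1) k * (t⁻¹ ^ b) ^ k = 0 := by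
  rw [Finset.sum_range_succ, ht.alternating_sum_qBinom_partial b b le_rfl, ht.qBinom_self,
    ht.qBinom_self, ← pow_mul, ← pow_mul, mul_comm b (b + 1)]
  ring

end IsGeneric

theorem qh_ne_zero : qh ≠ 0 := pow_ne_zero _ RatFunc.X_ne_zero

theorem qh_pow_ne_one {n : ℕ} (hn : n ≠ 0) : qh ^ n ≠ 1 := by
  intro h
  have h1 : (RatFunc.X : 𝕂) ^ (2 * n) = 1 := by
    rw [pow_mul]
    exact h
  rw [← RatFunc.algebraMap_X, ← map_pow, ← map_one (algebraMap (Polynomial ℚ) (RatFunc ℚ))] at h1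
  have h2 := congrArg Polynomial.natDegree (RatFunc.algebraMap_injective ℚ h1)
  simp at h2
  omega

theorem qd_isGeneric (A : GCM I) (i : I) : IsGeneric (qd A i) := by
  obtain ⟨d, hd⟩ := Int.eq_ofNat_of_zero_le (A.d_pos i).le
  have hd0 : d ≠ 0 := by
    rintro rfl
    exact (A.d_pos i).ne' hd
  have hq : qd A i = qh ^ d := by simp [qd, hd]
  have h0 : qd A i ≠ 0 := hq ▸ pow_ne_zero _ qh_ne_zero
  have key (n : ℕ) : qd A i ^ (n + 1) - (qd A i)⁻¹ ^ (n + 1) ≠ 0 := by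
    rw [sub_ne_zero, inv_pow, Ne, ← mul_eq_one_iff_eq_inv₀ (pow_ne_zero _ h0), ← pow_add, hq,
      ← pow_mul]
    exact qh_pow_ne_one (by positivity)
  have key0 : qd A i - (qd A i)⁻¹ ≠ 0 := by simpa using key 0
  exact ⟨h0, key0, fun n => div_ne_zero (key n) key0⟩

section SerrePolynomial

variable {R : Type} [Ring R] [Algebra 𝕂 R]

/-- The quantum Serre polynomial of degree `n` in `a` and degree one in `b`, with parameter `t`. -/
def serrePoly {R : Type} [Semiring R] [Algebra 𝕂 R] (t : 𝕂) (n : ℕ) (a b : R) : R :=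
  ∑ k ∈ Finset.range (n + 1), ((-1 : 𝕂) ^ k * qBinom t n k) • (a ^ k * b * a ^ (n - k))

theorem serreIn_eq_serrePoly (A : GCM I) (i j : I) (a b : R) :
    serreIn A i j a b = serrePoly (qd A i) ((1 - A.c i j).toNat) a b := rfl

theorem serrePoly_inv {R : Type} [Semiring R] [Algebra 𝕂 R] (t : 𝕂) (n : ℕ) (a b : R) :
    serrePoly t⁻¹ n a b = serrePoly t n a b := by
  simp only [serrePoly, qBinom_inv]

theorem map_serrePoly {S : Type} [Semiring S] [Algebra 𝕂 S] (f : R →ₐ[𝕂] S) (t : 𝕂) (n : ℕ)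
    (a b : R) : f (serrePoly t n a b) = serrePoly t n (f a) (f b) := by
  simp [serrePoly]

theorem serrePoly_add_right (t : 𝕂) (n : ℕ) (a b c : R) :
    serrePoly t n a (b + c) = serrePoly t n a b + serrePoly t n a c := by
  simp only [serrePoly, mul_add, add_mul, smul_add, Finset.sum_add_distrib]

theorem serrePoly_smul (t : 𝕂) (n : ℕ) (a b : R) (r s : 𝕂) :
    serrePoly t n (r • a) (s • b) = (r ^ n * s) • serrePoly t n a b := by
  simp only [serrePoly, Finset.smul_sum]
  refine Finset.sum_congr rfl fun k hk => ?_
  obtain ⟨m, rfl⟩ := Nat.exists_eq_add_of_le (Nat.lt_succ_iff.mp (Finset.mem_range.mp hk))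
  rw [Nat.add_sub_cancel_left, smul_pow, smul_pow, smul_mul_smul_comm, smul_mul_smul_comm,
    smul_smul, smul_smul]
  congr 1
  ring

theorem SemiconjBy.serrePoly {p a a' b b' : R} (ha : SemiconjBy p a a') (hb : SemiconjBy p b b')
    (t : 𝕂) (n : ℕ) : SemiconjBy p (serrePoly t n a b) (serrePoly t n a' b') := by
  unfold SemiconjBy _root_.serrePoly
  rw [Finset.mul_sum, Finset.sum_mul]
  refine Finset.sum_congr rfl fun k _ => ?_
  rw [mul_smul_comm, smul_mul_assoc,
    (((ha.pow_right k).mul_right hb).mul_right (ha.pow_right (n - k))).eq]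

theorem pow_mul_of_mul_eq_smul {a e : R} {s : 𝕂} (h : a * e = s • (e * a)) (k : ℕ) :
    a ^ k * e = s ^ k • (e * a ^ k) := by
  induction k with
  | zero => simp
  | succ k ih =>
    rw [pow_succ, mul_assoc, h, mul_smul_comm, ← mul_assoc, ih, smul_mul_assoc, smul_smul,
      mul_assoc, pow_succ']

theorem add_pow_of_mul_eq_smul {a e : R} {s : 𝕂} (h : a * e = s • (e * a))
    (he : e * e = 0) (m : ℕ) :
    (a + e) ^ m = a ^ m + (∑ l ∈ Finset.range m, s ^ l) • (e * a ^ (m - 1)) := by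
  have he' (k : ℕ) : e * a ^ k * e = 0 := by
    rw [mul_assoc, pow_mul_of_mul_eq_smul h, mul_smul_comm, ← mul_assoc, he, zero_mul, smul_zero]
  induction m with
  | zero => simp
  | succ m ih =>
    have h1 : (∑ l ∈ Finset.range m, s ^ l) • (e * a ^ (m - 1) * a) =
        (∑ l ∈ Finset.range m, s ^ l) • (e * a ^ m) := by
      cases m with
      | zero => simp
      | succ m => rw [Nat.add_sub_cancel, mul_assoc, ← pow_succ]
    rw [pow_succ, ih, add_mul, mul_add, mul_add, smul_mul_assoc, smul_mul_assoc, he', h1,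
      pow_mul_of_mul_eq_smul h, Finset.sum_range_succ, add_smul, Nat.add_sub_cancel, pow_succ]
    simp only [smul_zero, add_zero]
    abel

theorem IsGeneric.mul_geom_sum {t : 𝕂} (ht : IsGeneric t) (m : ℕ) :
    t * ∑ l ∈ Finset.range m, (t ^ 2) ^ l = t ^ m * qNum t m := by
  have h0 := ht.ne_zero
  have h1 := ht.sub_ne_zero
  have h2 : (∑ l ∈ Finset.range m, (t ^ 2) ^ l) * (t ^ 2 - 1) = (t ^ 2) ^ m - 1 :=
    geom_sum_mul _ _
  have h3 : t ^ m * t⁻¹ ^ m = 1 := by rw [← mul_pow, mul_inv_cancel₀ h0, one_pow]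
  have h4 : t * t⁻¹ = 1 := mul_inv_cancel₀ h0
  rw [qNum, mul_div_assoc', eq_div_iff h1]
  linear_combination h2 + h3 - (∑ l ∈ Finset.range m, (t ^ 2) ^ l) * h4

theorem serrePoly_add_right_of_mul_eq_smul {t : 𝕂} (ht : IsGeneric t) (n : ℕ) {a b e : R}
    (h : a * e = t⁻¹ ^ n • (e * a)) :
    serrePoly t (n + 1) a (b + e) = serrePoly t (n + 1) a b := by
  have h0 : serrePoly t (n + 1) a e = 0 := by
    have h1 : serrePoly t (n + 1) a e =
        (∑ k ∈ Finset.range (n + 2), (-1 : 𝕂) ^ k * qBinom t (n + 1) k * (t⁻¹ ^ n) ^ k) •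
          (e * a ^ (n + 1)) := by
      rw [serrePoly, Finset.sum_smul]
      refine Finset.sum_congr rfl fun k hk => ?_
      rw [pow_mul_of_mul_eq_smul h, smul_mul_assoc, smul_smul, mul_assoc e, ← pow_add,
        Nat.add_sub_cancel' (Nat.lt_succ_iff.mp (Finset.mem_range.mp hk))]
    rw [h1, ht.alternating_sum_qBinom, zero_smul]
  rw [serrePoly_add_right, h0, add_zero]

theorem serrePoly_add_left_of_mul_eq_smul {t : 𝕂} (ht : IsGeneric t) (n : ℕ) {a b e : R}
    (ha : a * e = t ^ 2 • (e * a)) (hb : b * e = t⁻¹ ^ n • (e * b))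
    (he : e * e = 0) :
    serrePoly t (n + 1) (a + e) b = serrePoly t (n + 1) a b := by
  set g : ℕ → 𝕂 := fun m => ∑ l ∈ Finset.range m, (t ^ 2) ^ l with hg
  set w : ℕ → 𝕂 := fun k => (-1) ^ k * qBinom t (n + 1) k with hw
  have expand (k : ℕ) : (a + e) ^ k * b * (a + e) ^ (n + 1 - k) = a ^ k * b * a ^ (n + 1 - k) +
      (g k • (e * (a ^ (k - 1) * b * a ^ (n + 1 - k))) +
        (g (n + 1 - k) * (t⁻¹ ^ n * (t ^ 2) ^ k)) • (e * (a ^ k * b * a ^ (n + 1 - k - 1)))) := by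
    have h1 : a ^ k * b * e = (t⁻¹ ^ n * (t ^ 2) ^ k) • (e * (a ^ k * b)) := by
      rw [mul_assoc, hb, mul_smul_comm, ← mul_assoc, pow_mul_of_mul_eq_smul ha, smul_mul_assoc,
        smul_smul, mul_assoc]
    have h2 : e * a ^ (k - 1) * b * (e * a ^ (n + 1 - k - 1)) = 0 := by
      rw [← mul_assoc, mul_assoc _ b e, hb, mul_smul_comm, ← mul_assoc, mul_assoc e,
        pow_mul_of_mul_eq_smul ha, mul_smul_comm, ← mul_assoc, he]
      simp
    rw [add_pow_of_mul_eq_smul ha he k, add_pow_of_mul_eq_smul ha he (n + 1 - k)]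
    simp only [add_mul, mul_add, smul_mul_assoc, mul_smul_comm, h2, smul_zero, add_zero]
    rw [← mul_assoc (a ^ k * b), h1, smul_mul_assoc, smul_smul]
    simp only [hg, mul_assoc]
    abel
  have cancel (k : ℕ) (hk : k ∈ Finset.range (n + 1)) :
      w (k + 1) * g (k + 1) + w k * (g (n + 1 - k) * (t⁻¹ ^ n * (t ^ 2) ^ k)) = 0 := by
    obtain ⟨m, rfl⟩ := Nat.exists_eq_add_of_le (Nat.lt_succ_iff.mp (Finset.mem_range.mp hk))
    rw [show k + m + 1 - k = m + 1 by omega]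
    have h0 := ht.ne_zero
    have h1 : t * g (k + 1) = t ^ (k + 1) * qNum t (k + 1) := ht.mul_geom_sum _
    have h2 : t * g (m + 1) = t ^ (m + 1) * qNum t (m + 1) := ht.mul_geom_sum _
    have h3 := ht.qBinom_succ_mul k m
    have h4 : t⁻¹ ^ (k + m) * t ^ (k + m) = 1 := by
      rw [← mul_pow, inv_mul_cancel₀ h0, one_pow]
    refine (mul_eq_zero.mp (?_ : t * _ = 0)).resolve_left h0
    simp only [hw]
    linear_combination (-1) ^ (k + 1) * qBinom t (k + m + 1) (k + 1) * h1 +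
      (-1) ^ k * qBinom t (k + m + 1) k * (t⁻¹ ^ (k + m) * (t ^ 2) ^ k) * h2 +
      (-1) ^ (k + 1) * t ^ (k + 1) * h3 +
      (-1) ^ k * qBinom t (k + m + 1) k * qNum t (m + 1) * t ^ (k + 1) * h4
  simp only [serrePoly]
  rw [Finset.sum_congr rfl fun k _ => congrArg (w k • ·) (expand k)]
  simp only [smul_add, Finset.sum_add_distrib]
  rw [add_eq_left, Finset.sum_range_succ', Finset.sum_range_succ _ (n + 1)]
  simp only [Nat.sub_self, hg, Finset.range_zero, Finset.sum_empty, zero_smul, zero_mul, smul_zero,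
    add_zero]
  rw [← Finset.sum_add_distrib]
  refine Finset.sum_eq_zero fun k hk => ?_
  rw [Nat.add_sub_cancel, show n + 1 - (k + 1) = n + 1 - k - 1 by omega, smul_smul, smul_smul,
    ← add_smul, cancel k hk, zero_smul]

theorem serrePoly_diagonal (t : 𝕂) (n : ℕ) (a a' b b' : R) :
    serrePoly t n !![a, 0; 0, a'] !![b, 0; 0, b'] =
      !![serrePoly t n a b, 0; 0, serrePoly t n a' b'] := by
  have hp (x y : R) (k : ℕ) : !![x, 0; 0, y] ^ k = !![x ^ k, 0; 0, y ^ k] := by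
    induction k with
    | zero => simp [Matrix.one_fin_two]
    | succ k ih => simp [pow_succ, ih]
  simp only [serrePoly, hp]
  ext i j
  fin_cases i <;> fin_cases j <;> simp [Matrix.sum_apply]

/-- The compatibility between the constants `u`, `v` of a twisted derivation and the twists
`r`, `s` under which that derivation annihilates the Serre polynomial of degree `n`. -/
structure SerreTwist (t : 𝕂) (n : ℕ) (r s u v : 𝕂) : Prop where
  left : u = 0 ∨ r = t ^ 2 ∧ s = t⁻¹ ^ (n - 1)
  right : v = 0 ∨ r = t⁻¹ ^ (n - 1)
  single : u = 0 ∨ v = 0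

theorem serrePoly_upperTriangular {t : 𝕂} (ht : IsGeneric t) {n : ℕ} (hn : n ≠ 0)
    {r s u v : 𝕂} (h : SerreTwist t n r s u v) (a b : R) :
    serrePoly t n !![r • a, algebraMap 𝕂 R u; 0, a] !![s • b, algebraMap 𝕂 R v; 0, b] =
      !![(r ^ n * s) • serrePoly t n a b, 0; 0, serrePoly t n a b] := by
  obtain ⟨n, rfl⟩ := Nat.exists_eq_succ_of_ne_zero hn
  rw [← serrePoly_smul, ← serrePoly_diagonal]
  have hsplit (c d x : R) : !![c, x; 0, d] = !![c, 0; 0, d] + !![0, x; 0, 0] := by simp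
  have hcomm (c : R) (y z : 𝕂) : !![y • c, 0; 0, c] * !![0, algebraMap 𝕂 R z; 0, 0] =
      y • (!![0, algebraMap 𝕂 R z; 0, 0] * !![y • c, 0; 0, c]) := by
    have hz := Algebra.commutes z c
    generalize algebraMap 𝕂 R z = x at hz
    simp [hz]
  rcases eq_or_ne v 0 with rfl | hv
  · rcases h.left with rfl | ⟨hr, hs⟩
    · simp
    · rw [hsplit (r • a)]
      simp only [map_zero]
      refine serrePoly_add_left_of_mul_eq_smul ht n ?_ ?_
        (by ext i j; fin_cases i <;> fin_cases j <;> simp)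
      · rw [hcomm, hr]
      · rw [hcomm, hs]
        simp
  · have hu := h.single.resolve_right hv
    have hr := h.right.resolve_left hv
    rw [hsplit (s • b)]
    subst hu
    simp only [map_zero]
    refine serrePoly_add_right_of_mul_eq_smul ht n ?_
    rw [hcomm, hr]
    simp

theorem mul_serrePoly_of_mul_eq {t : 𝕂} (ht : IsGeneric t) {n : ℕ} (hn : n ≠ 0)
    {r s u v : 𝕂} (h : SerreTwist t n r s u v) {a b y : R}
    (ha : y * a = r • (a * y) + algebraMap 𝕂 R u) (hb : y * b = s • (b * y) + algebraMap 𝕂 R v) :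
    y * serrePoly t n a b = (r ^ n * s) • (serrePoly t n a b * y) := by
  have key (c : R) (z w : 𝕂) (hc : y * c = z • (c * y) + algebraMap 𝕂 R w) :
      SemiconjBy !![1, y; 0, 1] !![z • c, 0; 0, c] !![z • c, algebraMap 𝕂 R w; 0, c] := by
    generalize algebraMap 𝕂 R w = x at hc
    simp [SemiconjBy, hc]
  have h1 := ((key a r u ha).serrePoly (key b s v hb) t n).eq
  rw [serrePoly_upperTriangular ht hn h, serrePoly_diagonal, serrePoly_smul] at h1
  simpa using congrFun (congrFun h1 0) 1

end SerrePolynomial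

/-- The sign with which the levels `m` and `p` enter the commutation relations. -/
def levelSign (m p : ℤ) : ℤ :=
  (if m < p then -1 else 1) * ((m.negOnePow : ℤ) * (p.negOnePow : ℤ))

theorem negOnePow_add_one (m : ℤ) : ((m + 1).negOnePow : ℤ) = -(m.negOnePow : ℤ) := by
  rw [Int.negOnePow_succ, Units.val_neg]

theorem levelSign_self_add_one (m : ℤ) : levelSign m (m + 1) = 1 := by
  simp [levelSign, negOnePow_add_one]

theorem levelSign_of_lt {m p : ℤ} (h : m < p) :
    levelSign m p = ((p - m + 1).negOnePow : ℤ) := by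
  rw [negOnePow_add_one, Int.negOnePow_sub, Units.val_mul, levelSign, if_pos h]
  ring

theorem levelSign_swap {m p : ℤ} (h : m ≠ p) : levelSign p m = -levelSign m p := by
  rcases h.lt_or_gt with h | h
  · rw [levelSign, levelSign, if_pos h, if_neg h.not_gt]
    ring
  · rw [levelSign, levelSign, if_pos h, if_neg h.not_gt]
    ring

theorem levelSign_add_one_right_of_le {m p : ℤ} (h : m ≤ p) :
    levelSign m (p + 1) = levelSign p m := by
  rw [levelSign, levelSign, if_pos (by omega), if_neg (by omega), negOnePow_add_one]
  ring

theorem levelSign_add_one_right_of_lt {m p : ℤ} (h : m < p) :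
    levelSign m (p + 1) = -levelSign m p := by
  rw [levelSign, levelSign, if_pos (by omega), if_pos h, negOnePow_add_one]
  ring

theorem levelSign_add_one_left_of_lt {m p : ℤ} (h : m < p) :
    levelSign p (m + 1) = levelSign m p := by
  rw [levelSign, levelSign, if_neg (by omega), if_pos h, negOnePow_add_one]
  ring

theorem levelSign_add_one_left {m p : ℤ} (h : m + 1 < p) :
    levelSign (m + 1) p = -levelSign m p := by
  rw [levelSign, levelSign, if_pos (by omega), if_pos (by omega), negOnePow_add_one]
  ring

/-- The exponent of `q` in the commutation relation between the generators `g` and `h`. -/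
def commExp (A : GCM I) (g h : I × ℤ) : ℤ :=
  levelSign g.2 h.2 * (A.d g.1 * A.c g.1 h.1)

/-- The constant term in the commutation relation between the generators `g` and `h`. -/
def commConst (A : GCM I) (g h : I × ℤ) : 𝕂 :=
  if h = (g.1, g.2 + 1) then zi A g.1 else 0

theorem commConst_of_ne (A : GCM I) {g h : I × ℤ} (hne : h.2 ≠ g.2 + 1) :
    commConst A g h = 0 :=
  if_neg fun e => hne (congrArg Prod.snd e)

theorem commExp_swap (A : GCM I) {g h : I × ℤ} (hne : g.2 ≠ h.2) :
    commExp A h g = -commExp A g h := by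
  rw [commExp, commExp, levelSign_swap hne, A.dsymm h.1 g.1]
  ring

theorem SerreTwist.of_eq_zero (t : 𝕂) (n : ℕ) (r s : 𝕂) : SerreTwist t n r s 0 0 :=
  ⟨.inl rfl, .inl rfl, .inl rfl⟩

theorem serreTwist_zpow (A : GCM I) {i j : I} (hij : i ≠ j) (k : I) {x u v : 𝕂}
    (hu : u = 0 ∨ i = k) (hv : v = 0 ∨ j = k) :
    SerreTwist (x ^ A.d i) ((1 - A.c i j).toNat) (x ^ (A.d k * A.c k i))
      (x ^ (A.d k * A.c k j)) u v := by
  have hc := A.offdiag i j hij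
  have hp : (x ^ A.d i)⁻¹ ^ ((1 - A.c i j).toNat - 1) = x ^ (A.d i * A.c i j) := by
    rw [inv_pow, ← zpow_natCast, ← zpow_mul, ← zpow_neg]
    congr 1
    rw [show ((((1 - A.c i j).toNat - 1 : ℕ)) : ℤ) = -A.c i j by omega]
    ring
  refine ⟨hu.imp_right ?_, hv.imp_right ?_, ?_⟩
  · rintro rfl
    refine ⟨?_, hp.symm⟩
    rw [A.diag, ← zpow_natCast (x ^ A.d i), ← zpow_mul]
    rfl
  · rintro rfl
    rw [hp, A.dsymm]
  · rcases hu with hu | hu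
    · exact .inl hu
    · exact .inr (hv.resolve_right fun h => hij (hu.trans h.symm))

theorem serreDegree_ne_zero (A : GCM I) {i j : I} (hij : i ≠ j) : (1 - A.c i j).toNat ≠ 0 := by
  have := A.offdiag i j hij
  omega

/-- The defining relations of the bosonic extension with the constant terms dropped. -/
inductive QRel (A : GCM I) : FreeAlgebra 𝕂 (I × ℤ) → FreeAlgebra 𝕂 (I × ℤ) → Prop
  | serre (i j : I) (p : ℤ) (h : i ≠ j) :
      QRel A (serreIn A i j (FreeAlgebra.ι 𝕂 (i, p)) (FreeAlgebra.ι 𝕂 (j, p))) 0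
  | comm (g h : I × ℤ) (hlt : g.2 < h.2) :
      QRel A (FreeAlgebra.ι 𝕂 g * FreeAlgebra.ι 𝕂 h)
        (qh ^ commExp A g h • (FreeAlgebra.ι 𝕂 h * FreeAlgebra.ι 𝕂 g))

/-- The `q`-commutative degeneration of the bosonic extension. -/
abbrev QAlg (A : GCM I) : Type := RingQuot (QRel A)

namespace QAlg

/-- The generators of `QAlg A`. -/
def gen (A : GCM I) (g : I × ℤ) : QAlg A :=
  RingQuot.mkAlgHom 𝕂 (QRel A) (FreeAlgebra.ι 𝕂 g)

theorem serrePoly_gen (A : GCM I) {i j : I} (p : ℤ) (h : i ≠ j) :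
    serrePoly (qd A i) ((1 - A.c i j).toNat) (gen A (i, p)) (gen A (j, p)) = 0 := by
  have h1 := RingQuot.mkAlgHom_rel 𝕂 (QRel.serre (A := A) i j p h)
  rwa [serreIn_eq_serrePoly, map_serrePoly, map_zero] at h1

theorem gen_mul_gen (A : GCM I) {g h : I × ℤ} (hne : g.2 ≠ h.2) :
    gen A g * gen A h = qh ^ commExp A g h • (gen A h * gen A g) := by
  have key {g h : I × ℤ} (hlt : g.2 < h.2) :
      gen A g * gen A h = qh ^ commExp A g h • (gen A h * gen A g) := by
    have h1 := RingQuot.mkAlgHom_rel 𝕂 (QRel.comm (A := A) g h hlt)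
    rwa [map_mul, map_smul, map_mul] at h1
  rcases hne.lt_or_gt with hlt | hlt
  · exact key hlt
  · rw [key hlt, smul_smul, commExp_swap A hne, zpow_neg,
      mul_inv_cancel₀ (zpow_ne_zero _ qh_ne_zero), one_smul]

/-- An algebra homomorphism out of `QAlg A` is given by images of the generators satisfying the
relations. -/
def lift (A : GCM I) {R : Type} [Semiring R] [Algebra 𝕂 R] (f : I × ℤ → R)
    (hserre : ∀ i j p, i ≠ j →
      serrePoly (qd A i) ((1 - A.c i j).toNat) (f (i, p)) (f (j, p)) = 0)
    (hcomm : ∀ g h : I × ℤ, g.2 < h.2 → f g * f h = qh ^ commExp A g h • (f h * f g)) :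
    QAlg A →ₐ[𝕂] R :=
  RingQuot.liftAlgHom 𝕂 ⟨FreeAlgebra.lift 𝕂 f, by
    rintro _ _ (⟨i, j, p, h⟩ | ⟨g, h, hlt⟩)
    · simpa [serreIn_eq_serrePoly, map_serrePoly] using hserre i j p h
    · simpa using hcomm g h hlt⟩

theorem lift_gen (A : GCM I) {R : Type} [Semiring R] [Algebra 𝕂 R] (f : I × ℤ → R) (hserre hcomm)
    (g : I × ℤ) : lift A f hserre hcomm (gen A g) = f g := by
  rw [lift, gen, RingQuot.liftAlgHom_mkAlgHom_apply, FreeAlgebra.lift_ι_apply]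

theorem mem_of_gen_mul_mem {A : GCM I} (P : Submodule 𝕂 (QAlg A)) (h1 : 1 ∈ P)
    (hmul : ∀ g x, x ∈ P → gen A g * x ∈ P) (x : QAlg A) : x ∈ P := by
  have key (y : FreeAlgebra 𝕂 (I × ℤ)) : ∀ z ∈ P, RingQuot.mkAlgHom 𝕂 (QRel A) y * z ∈ P := by
    induction y using FreeAlgebra.induction with
    | grade0 r =>
      intro z hz
      rw [AlgHom.commutes, ← Algebra.smul_def]
      exact P.smul_mem r hz
    | grade1 g => exact hmul g
    | mul a b ha hb =>
      intro z hz
      rw [map_mul, mul_assoc]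
      exact ha _ (hb z hz)
    | add a b ha hb =>
      intro z hz
      rw [map_add, add_mul]
      exact P.add_mem (ha z hz) (hb z hz)
  obtain ⟨y, rfl⟩ := RingQuot.mkAlgHom_surjective 𝕂 (QRel A) x
  simpa using key y 1 h1

/-- The matrix encoding the twisted derivation attached to `g`, on the generator `h`. -/
def derivMatrix (A : GCM I) (g h : I × ℤ) : Matrix (Fin 2) (Fin 2) (QAlg A) :=
  !![qh ^ commExp A g h • gen A h, algebraMap 𝕂 (QAlg A) (commConst A g h); 0, gen A h]

theorem serrePoly_derivMatrix (A : GCM I) (g : I × ℤ) {i j : I} (p : ℤ) (h : i ≠ j) :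
    serrePoly (qd A i) ((1 - A.c i j).toNat) (derivMatrix A g (i, p)) (derivMatrix A g (j, p)) =
      0 := by
  have twist : SerreTwist (qd A i) ((1 - A.c i j).toNat) (qh ^ commExp A g (i, p))
      (qh ^ commExp A g (j, p)) (commConst A g (i, p)) (commConst A g (j, p)) := by
    by_cases hp : p = g.2 + 1
    · subst hp
      simp only [commExp, levelSign_self_add_one, one_mul]
      refine serreTwist_zpow A h g.1 ?_ ?_
      · by_cases hi : i = g.1
        · exact .inr hi
        · exact .inl (if_neg fun e => hi (congrArg Prod.fst e))
      · by_cases hj : j = g.1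
        · exact .inr hj
        · exact .inl (if_neg fun e => hj (congrArg Prod.fst e))
    · rw [commConst_of_ne A (h := (i, p)) hp, commConst_of_ne A (h := (j, p)) hp]
      exact .of_eq_zero ..
  refine (serrePoly_upperTriangular (qd_isGeneric A i) (serreDegree_ne_zero A h) twist
    (gen A (i, p)) (gen A (j, p))).trans ?_
  rw [serrePoly_gen A p h]
  simp [← Matrix.ext_iff]

theorem derivMatrix_mul (A : GCM I) (g : I × ℤ) {h k : I × ℤ} (hlt : h.2 < k.2) :
    derivMatrix A g h * derivMatrix A g k =
      qh ^ commExp A h k • (derivMatrix A g k * derivMatrix A g h) := by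
  have hc := gen_mul_gen A hlt.ne
  have h01 : (commConst A g k * qh ^ commExp A g h) • gen A h + commConst A g h • gen A k =
      (qh ^ commExp A h k * (qh ^ commExp A g k * commConst A g h)) • gen A k +
        (qh ^ commExp A h k * commConst A g k) • gen A h := by
    by_cases hk : k = (g.1, g.2 + 1)
    · subst hk
      have e : commExp A g h = commExp A h (g.1, g.2 + 1) := by
        rw [commExp, commExp, levelSign_add_one_right_of_le (by simp at hlt; omega), A.dsymm]
      rw [commConst_of_ne A (h := h) (by simp at hlt; omega), e]
      simp [mul_comm]
    · by_cases hh : h = (g.1, g.2 + 1)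
      · subst hh
        have e : commExp A g k = -commExp A (g.1, g.2 + 1) k := by
          rw [commExp, commExp, levelSign_add_one_left hlt]
          ring
        rw [show commConst A g k = 0 from if_neg hk, e, ← mul_assoc, zpow_neg,
          mul_inv_cancel₀ (zpow_ne_zero _ qh_ne_zero)]
        simp
      · simp [commConst, hh, hk]
  ext a b
  fin_cases a <;> fin_cases b
  · simp [derivMatrix, Matrix.mul_apply, Fin.sum_univ_two, smul_smul, hc]
    congr 1
    ring
  · simpa [derivMatrix, Matrix.mul_apply, Fin.sum_univ_two, smul_smul,
      Algebra.algebraMap_eq_smul_one, smul_add] using h01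
  · simp [derivMatrix, Matrix.mul_apply, Fin.sum_univ_two]
  · simpa [derivMatrix, Matrix.mul_apply, Fin.sum_univ_two] using hc

/-- The algebra homomorphism `x ↦ !![K x, D x; 0, x]`, where `D` is the twisted derivation
attached to `g` and `K` is its twist. -/
def derivHom (A : GCM I) (g : I × ℤ) : QAlg A →ₐ[𝕂] Matrix (Fin 2) (Fin 2) (QAlg A) :=
  lift A (derivMatrix A g) (fun _ _ p h => serrePoly_derivMatrix A g p h)
    fun _ _ hlt => derivMatrix_mul A g hlt

/-- The twisted derivation of `QAlg A` attached to the generator `g`. -/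
def deriv (A : GCM I) (g : I × ℤ) : QAlg A →ₗ[𝕂] QAlg A :=
  Matrix.entryLinearMap 𝕂 (QAlg A) 0 1 ∘ₗ (derivHom A g).toLinearMap

theorem deriv_apply (A : GCM I) (g : I × ℤ) (x : QAlg A) : deriv A g x = derivHom A g x 0 1 := rfl

theorem derivHom_gen_mul (A : GCM I) (g h : I × ℤ) (x : QAlg A) :
    derivHom A g (gen A h * x) = derivMatrix A g h * derivHom A g x := by
  rw [map_mul, derivHom, lift_gen]

theorem derivHom_apply_one_one (A : GCM I) (g : I × ℤ) (x : QAlg A) : derivHom A g x 1 1 = x := by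
  refine mem_of_gen_mul_mem (LinearMap.eqLocus
    (Matrix.entryLinearMap 𝕂 (QAlg A) 1 1 ∘ₗ (derivHom A g).toLinearMap) LinearMap.id) ?_ ?_ x
  · simp [LinearMap.mem_eqLocus]
  · intro h x hx
    rw [LinearMap.mem_eqLocus] at hx ⊢
    change derivHom A g x 1 1 = x at hx
    change derivHom A g (gen A h * x) 1 1 = gen A h * x
    rw [derivHom_gen_mul, Matrix.mul_apply, Fin.sum_univ_two, hx]
    simp [derivMatrix]

theorem deriv_one (A : GCM I) (g : I × ℤ) : deriv A g 1 = 0 := by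
  simp [deriv_apply]

theorem deriv_gen_mul (A : GCM I) (g h : I × ℤ) (x : QAlg A) :
    deriv A g (gen A h * x) =
      qh ^ commExp A g h • (gen A h * deriv A g x) + commConst A g h • x := by
  rw [deriv_apply, derivHom_gen_mul, Matrix.mul_apply, Fin.sum_univ_two, derivHom_apply_one_one,
    deriv_apply]
  simp [derivMatrix, Algebra.smul_def (commConst A g h)]

theorem deriv_deriv (A : GCM I) {g h : I × ℤ} (hlt : g.2 < h.2) (x : QAlg A) :
    deriv A g (deriv A h x) = qh ^ commExp A g h • deriv A h (deriv A g x) := by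
  refine mem_of_gen_mul_mem (LinearMap.eqLocus (deriv A g ∘ₗ deriv A h)
    (qh ^ commExp A g h • (deriv A h ∘ₗ deriv A g))) ?_ ?_ x
  · simp [LinearMap.mem_eqLocus, deriv_one]
  · intro k x hx
    rw [LinearMap.mem_eqLocus] at hx ⊢
    change deriv A g (deriv A h x) = qh ^ commExp A g h • deriv A h (deriv A g x) at hx
    change deriv A g (deriv A h (gen A k * x)) =
      qh ^ commExp A g h • deriv A h (deriv A g (gen A k * x))
    have e1 : commConst A h k = qh ^ commExp A g h * (qh ^ commExp A g k * commConst A h k) := by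
      by_cases hk : k = (h.1, h.2 + 1)
      · have e : commExp A g k = -commExp A g h := by
          rw [hk, commExp, commExp, levelSign_add_one_right_of_lt hlt]
          ring
        rw [e, ← mul_assoc, zpow_neg, mul_inv_cancel₀ (zpow_ne_zero _ qh_ne_zero), one_mul]
      · simp [commConst, hk]
    have e2 : qh ^ commExp A h k * commConst A g k = qh ^ commExp A g h * commConst A g k := by
      by_cases hk : k = (g.1, g.2 + 1)
      · have e : commExp A h k = commExp A g h := by
          rw [hk, commExp, commExp, levelSign_add_one_left_of_lt hlt, A.dsymm]
        rw [e]
      · simp [commConst, hk]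
    simp only [deriv_gen_mul, map_add, map_smul, hx, smul_add, smul_smul, mul_smul_comm]
    rw [e2, ← e1, show qh ^ commExp A h k * (qh ^ commExp A g k * qh ^ commExp A g h) =
      qh ^ commExp A g h * (qh ^ commExp A g k * qh ^ commExp A h k) by ring]
    abel

/-- The operator on `QAlg A` by which the generator `g` of the bosonic extension acts. -/
def op (A : GCM I) (g : I × ℤ) : Module.End 𝕂 (QAlg A) :=
  LinearMap.mulLeft 𝕂 (gen A g) + deriv A g

theorem op_apply (A : GCM I) (g : I × ℤ) (x : QAlg A) :
    op A g x = gen A g * x + deriv A g x := rfl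

theorem op_mul_op (A : GCM I) {g h : I × ℤ} (hlt : g.2 < h.2) :
    op A g * op A h = qh ^ commExp A g h • (op A h * op A g) + commConst A g h • 1 := by
  ext x
  simp only [Module.End.mul_apply, LinearMap.add_apply, LinearMap.smul_apply, Module.End.one_apply,
    op_apply, map_add, deriv_gen_mul, deriv_deriv A hlt, smul_add, smul_smul]
  rw [commConst_of_ne A (g := h) (h := g) (by omega), ← mul_assoc, gen_mul_gen A hlt.ne,
    commExp_swap A hlt.ne, zpow_neg, mul_inv_cancel₀ (zpow_ne_zero _ qh_ne_zero), smul_mul_assoc,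
    mul_assoc]
  simp only [zero_smul, one_smul, mul_zero]
  abel

theorem mulLeft_gen_mul_op (A : GCM I) {g h : I × ℤ} (hne : h.2 ≠ g.2) :
    LinearMap.mulLeft 𝕂 (gen A h) * op A g =
      qh ^ (-commExp A g h) • (op A g * LinearMap.mulLeft 𝕂 (gen A h)) +
        algebraMap 𝕂 _ (-(qh ^ (-commExp A g h) * commConst A g h)) := by
  ext x
  have hq : qh ^ commExp A g h ≠ 0 := zpow_ne_zero _ qh_ne_zero
  simp only [Module.End.mul_apply, LinearMap.add_apply, LinearMap.smul_apply,
    Module.algebraMap_end_apply, op_apply, LinearMap.mulLeft_apply, deriv_gen_mul, mul_add,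
    smul_add, smul_smul, zpow_neg, inv_mul_cancel₀ hq, one_smul, neg_smul]
  rw [← mul_assoc, gen_mul_gen A hne, commExp_swap A hne.symm, zpow_neg, smul_mul_assoc, mul_assoc]
  abel

theorem deriv_prod_gen (A : GCM I) (g : I × ℤ) (l : List I) :
    deriv A g (l.map fun k => gen A (k, g.2)).prod = 0 := by
  induction l with
  | nil => exact deriv_one A g
  | cons k l ih =>
    rw [List.map_cons, List.prod_cons, deriv_gen_mul, ih, commConst_of_ne A (by simp)]
    simp

theorem prod_gen_mul_gen (A : GCM I) (p : ℤ) {g : I × ℤ} (hg : g.2 ≠ p) (l : List I) :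
    ∃ r : 𝕂, (l.map fun k => gen A (k, p)).prod * gen A g =
      r • (gen A g * (l.map fun k => gen A (k, p)).prod) := by
  induction l with
  | nil => exact ⟨1, by simp⟩
  | cons k l ih =>
    obtain ⟨r, hr⟩ := ih
    refine ⟨r * qh ^ commExp A (k, p) g, ?_⟩
    rw [List.map_cons, List.prod_cons, mul_assoc, hr, mul_smul_comm, ← mul_assoc,
      gen_mul_gen A (g := (k, p)) hg.symm, smul_mul_assoc, smul_smul, mul_assoc]

theorem serrePoly_op (A : GCM I) {i j : I} (p : ℤ) (hij : i ≠ j) :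
    serrePoly (qd A i) ((1 - A.c i j).toNat) (op A (i, p)) (op A (j, p)) = 0 := by
  set S := serrePoly (qd A i) ((1 - A.c i j).toNat) (op A (i, p)) (op A (j, p)) with hS
  have hgen (g : I × ℤ) (hg : g.2 ≠ p) (x : QAlg A) (hx : S x = 0) : S (gen A g * x) = 0 := by
    have twist : SerreTwist (qd A i)⁻¹ ((1 - A.c i j).toNat) (qh ^ (-commExp A (i, p) g))
        (qh ^ (-commExp A (j, p) g)) (-(qh ^ (-commExp A (i, p) g) * commConst A (i, p) g))
        (-(qh ^ (-commExp A (j, p) g) * commConst A (j, p) g)) := by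
      by_cases hp : g.2 = p + 1
      · have e (k : I) : qh ^ (-commExp A (k, p) g) = qh⁻¹ ^ (A.d g.1 * A.c g.1 k) := by
          rw [inv_zpow', commExp, hp, levelSign_self_add_one, A.dsymm, one_mul]
        have hz (k : I) : -(qh ^ (-commExp A (k, p) g) * commConst A (k, p) g) = 0 ∨ k = g.1 := by
          by_cases hk : k = g.1
          · exact .inr hk
          · left
            rw [show commConst A (k, p) g = 0 from
              if_neg fun e => hk (congrArg Prod.fst e).symm, mul_zero, neg_zero]
        have h := serreTwist_zpow A hij g.1 (x := qh⁻¹) (hz i) (hz j)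
        rwa [inv_zpow qh (A.d i), ← e, ← e] at h
      · rw [commConst_of_ne A (g := (i, p)) hp, commConst_of_ne A (g := (j, p)) hp]
        simpa using SerreTwist.of_eq_zero ..
    have h : LinearMap.mulLeft 𝕂 (gen A g) * S =
        ((qh ^ (-commExp A (i, p) g)) ^ (1 - A.c i j).toNat * qh ^ (-commExp A (j, p) g)) •
          (S * LinearMap.mulLeft 𝕂 (gen A g)) := by
      rw [hS, ← serrePoly_inv]
      exact mul_serrePoly_of_mul_eq (R := Module.End 𝕂 (QAlg A)) (qd_isGeneric A i).inv
        (serreDegree_ne_zero A hij) twist (mulLeft_gen_mul_op A (g := (i, p)) hg)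
        (mulLeft_gen_mul_op A (g := (j, p)) hg)
    have h2 := LinearMap.congr_fun h x
    simp only [Module.End.mul_apply, LinearMap.smul_apply, LinearMap.mulLeft_apply, hx,
      mul_zero] at h2
    refine (smul_eq_zero.mp h2.symm).resolve_left ?_
    exact mul_ne_zero (pow_ne_zero _ (zpow_ne_zero _ qh_ne_zero)) (zpow_ne_zero _ qh_ne_zero)
  have hop (k : I) (l : List I) : op A (k, p) (l.map fun k => gen A (k, p)).prod =
      ((k :: l).map fun k => gen A (k, p)).prod := by
    rw [op_apply, deriv_prod_gen A (k, p), add_zero, List.map_cons, List.prod_cons]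
  have hpow (k : I) (n : ℕ) (l : List I) :
      (op A (k, p) ^ n) (l.map fun k => gen A (k, p)).prod =
        ((List.replicate n k ++ l).map fun k => gen A (k, p)).prod := by
    induction n with
    | zero => simp
    | succ n ih =>
      rw [pow_succ', Module.End.mul_apply, ih, hop, List.replicate_succ, List.cons_append]
  have hlevel (l : List I) : S (l.map fun k => gen A (k, p)).prod = 0 := by
    rw [← zero_mul (l.map fun k => gen A (k, p)).prod, ← serrePoly_gen A p hij, hS, serrePoly,
      serrePoly, LinearMap.sum_apply, Finset.sum_mul]
    refine Finset.sum_congr rfl fun n _ => ?_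
    rw [LinearMap.smul_apply, Module.End.mul_apply, Module.End.mul_apply, hpow, hop, hpow]
    simp [mul_assoc]
  have hall (x : QAlg A) :
      x ∈ (⨅ l : List I, LinearMap.ker
        (S ∘ₗ LinearMap.mulLeft 𝕂 (l.map fun k => gen A (k, p)).prod)) := by
    refine mem_of_gen_mul_mem _ ?_ ?_ x
    · simpa [Submodule.mem_iInf] using hlevel
    · intro g x hx
      simp only [Submodule.mem_iInf, LinearMap.mem_ker, LinearMap.comp_apply,
        LinearMap.mulLeft_apply] at hx ⊢
      intro l
      by_cases hg : g.2 = p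
      · have h := hx (l ++ [g.1])
        rw [List.map_append, List.prod_append, List.map_singleton, List.prod_singleton, ← hg,
          mul_assoc] at h
        rwa [← hg]
      · obtain ⟨r, hr⟩ := prod_gen_mul_gen A p hg l
        rw [← mul_assoc, hr, smul_mul_assoc, map_smul, mul_assoc, hgen g hg _ (hx l), smul_zero]
  ext x
  have h := hall x
  simp only [Submodule.mem_iInf, LinearMap.mem_ker, LinearMap.comp_apply,
    LinearMap.mulLeft_apply] at h
  simpa using h []

end QAlg

section Bosonic

theorem serrePoly_ff (A : GCM I) {i j : I} (p : ℤ) (h : i ≠ j) :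
    serrePoly (qd A i) ((1 - A.c i j).toNat) (ff A i p) (ff A j p) = 0 := by
  have h1 := RingQuot.mkAlgHom_rel 𝕂 (hARel.serre (A := A) i j p h)
  rwa [serreIn_eq_serrePoly, map_serrePoly, map_zero] at h1

theorem commTerm_eq (A : GCM I) {R : Type} [Ring R] [Algebra 𝕂 R] (i j : I) (m p : ℤ) :
    (if j = i ∧ p = m + 1 then ((1 : 𝕂) - qd A i ^ 2) • (1 : R) else 0) =
      commConst A (i, m) (j, p) • 1 := by
  simp only [commConst, Prod.mk.injEq]
  split_ifs with h
  · rfl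
  · rw [zero_smul]

theorem ff_mul_ff (A : GCM I) {g h : I × ℤ} (hlt : g.2 < h.2) :
    ff A g.1 g.2 * ff A h.1 h.2 =
      qh ^ commExp A g h • (ff A h.1 h.2 * ff A g.1 g.2) + commConst A g h • 1 := by
  have h1 := RingQuot.mkAlgHom_rel 𝕂 (hARel.comm (A := A) g.1 h.1 g.2 h.2 hlt)
  rw [commTerm_eq, ← levelSign_of_lt hlt] at h1
  simpa [commExp, ff] using h1

/-- An algebra homomorphism out of the bosonic extension is given by images of the generators
satisfying the relations. -/
def hALift (A : GCM I) {R : Type} [Ring R] [Algebra 𝕂 R] (f : I × ℤ → R)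
    (hserre : ∀ i j p, i ≠ j →
      serrePoly (qd A i) ((1 - A.c i j).toNat) (f (i, p)) (f (j, p)) = 0)
    (hcomm : ∀ g h : I × ℤ, g.2 < h.2 →
      f g * f h = qh ^ commExp A g h • (f h * f g) + commConst A g h • 1) :
    hA A →ₐ[𝕂] R :=
  RingQuot.liftAlgHom 𝕂 ⟨FreeAlgebra.lift 𝕂 f, by
    rintro _ _ (⟨i, j, p, h⟩ | ⟨i, j, m, p, hlt⟩)
    · simpa [serreIn_eq_serrePoly, map_serrePoly] using hserre i j p h
    · rw [commTerm_eq, ← levelSign_of_lt hlt]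
      simpa [commExp] using hcomm (i, m) (j, p) hlt⟩

theorem hALift_ff (A : GCM I) {R : Type} [Ring R] [Algebra 𝕂 R] (f : I × ℤ → R) (hserre hcomm)
    (i : I) (p : ℤ) : hALift A f hserre hcomm (ff A i p) = f (i, p) := by
  rw [hALift, ff, RingQuot.liftAlgHom_mkAlgHom_apply, FreeAlgebra.lift_ι_apply]

theorem hA_algHom_ext (A : GCM I) {R : Type} [Ring R] [Algebra 𝕂 R] {φ ψ : hA A →ₐ[𝕂] R}
    (h : ∀ g : I × ℤ, φ (ff A g.1 g.2) = ψ (ff A g.1 g.2)) : φ = ψ :=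
  RingQuot.ringQuot_ext' 𝕂 _ _ (FreeAlgebra.hom_ext (funext h))

/-- The representation of the bosonic extension on `QAlg A`. -/
def hARep (A : GCM I) : hA A →ₐ[𝕂] Module.End 𝕂 (QAlg A) :=
  hALift A (QAlg.op A) (fun _ _ p h => QAlg.serrePoly_op A p h) fun _ _ h => QAlg.op_mul_op A h

/-- The exponent of `q` by which `hATwist A g` scales the generator `h`. -/
def twistExp (A : GCM I) (g h : I × ℤ) : ℤ :=
  -((g.2.negOnePow : ℤ) * (h.2.negOnePow : ℤ)) * (A.d g.1 * A.c g.1 h.1)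

theorem twistExp_of_lt (A : GCM I) {g h : I × ℤ} (hlt : g.2 < h.2) :
    twistExp A g h = commExp A g h := by
  rw [twistExp, commExp, levelSign, if_pos hlt]
  ring

/-- The automorphism of the bosonic extension rescaling each generator according to the pairing of
its weight with that of `g`. -/
def hATwist (A : GCM I) (g : I × ℤ) : hA A →ₐ[𝕂] hA A :=
  hALift A (fun h => qh ^ twistExp A g h • ff A h.1 h.2)
    (fun i j p h => by rw [serrePoly_smul, serrePoly_ff A p h, smul_zero])
    (fun h k hlt => by
      have hc : (qh ^ twistExp A g h * qh ^ twistExp A g k) * commConst A h k =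
          commConst A h k := by
        by_cases hk : k = (h.1, h.2 + 1)
        · have e : twistExp A g k = -twistExp A g h := by
            rw [hk, twistExp, twistExp, negOnePow_add_one]
            ring
          rw [e, zpow_neg, mul_inv_cancel₀ (zpow_ne_zero _ qh_ne_zero), one_mul]
        · simp [commConst, hk]
      rw [smul_mul_smul_comm, smul_mul_smul_comm, ff_mul_ff A hlt, smul_add, smul_smul, smul_smul,
        hc, smul_smul]
      congr 2
      ring)

theorem hATwist_ff (A : GCM I) (g h : I × ℤ) :
    hATwist A g (ff A h.1 h.2) = qh ^ twistExp A g h • ff A h.1 h.2 :=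
  hALift_ff ..

theorem hATwist_hATwist (A : GCM I) (g h : I × ℤ) (x : hA A) :
    hATwist A g (hATwist A h x) = hATwist A h (hATwist A g x) := by
  have e : (hATwist A g).comp (hATwist A h) = (hATwist A h).comp (hATwist A g) := by
    refine hA_algHom_ext A fun k => ?_
    simp only [AlgHom.comp_apply, hATwist_ff, map_smul]
    rw [smul_comm]
  exact DFunLike.congr_fun e x

theorem ff_mem_hAk (A : GCM I) (i : I) (p : ℤ) : ff A i p ∈ hAk A p :=
  Algebra.subset_adjoin ⟨i, p, le_rfl, le_rfl, rfl⟩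

theorem hATwist_mem_hAk (A : GCM I) (g : I × ℤ) {r : ℤ} {x : hA A} (hx : x ∈ hAk A r) :
    hATwist A g x ∈ hAk A r := by
  have h : hAk A r ≤ (hAk A r).comap (hATwist A g) := by
    refine Algebra.adjoin_le ?_
    rintro _ ⟨i, k, h1, h2, rfl⟩
    obtain rfl := le_antisymm h1 h2
    rw [SetLike.mem_coe, Subalgebra.mem_comap, hATwist_ff A g (i, r)]
    exact Subalgebra.smul_mem _ (ff_mem_hAk A i r) _
  exact h hx

/-- The subspace `Â[r]`. -/
abbrev levelSpace (A : GCM I) (r : ℤ) : Submodule 𝕂 (hA A) := Subalgebra.toSubmodule (hAk A r)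

/-- The unit of `Â[r]`. -/
def levelUnit (A : GCM I) (r : ℤ) : levelSpace A r := ⟨1, (hAk A r).one_mem⟩

/-- The operator on the bosonic extension by which the generator `g` of `QAlg A` acts on the tensor
factor of level `r`. -/
def slotEnd (A : GCM I) (g : I × ℤ) (r : ℤ) : Module.End 𝕂 (hA A) :=
  if r = g.2 then LinearMap.mulLeft 𝕂 (ff A g.1 g.2)
  else if g.2 < r then (hATwist A g).toLinearMap else 1

theorem slotEnd_mem (A : GCM I) (g : I × ℤ) (r : ℤ) :
    ∀ x ∈ levelSpace A r, slotEnd A g r x ∈ levelSpace A r := by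
  intro x hx
  unfold slotEnd
  split_ifs with h1 h2
  · subst h1
    exact (hAk A g.2).mul_mem (ff_mem_hAk A g.1 g.2) hx
  · exact hATwist_mem_hAk A g hx
  · exact hx

/-- The restriction of `slotEnd A g r` to `Â[r]`. -/
def slot (A : GCM I) (g : I × ℤ) (r : ℤ) : Module.End 𝕂 (levelSpace A r) :=
  (slotEnd A g r).restrict (slotEnd_mem A g r)

theorem coe_slot (A : GCM I) (g : I × ℤ) (r : ℤ) (x : levelSpace A r) :
    (slot A g r x : hA A) = slotEnd A g r x := rfl

theorem slotEnd_self (A : GCM I) (g : I × ℤ) (x : hA A) :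
    slotEnd A g g.2 x = ff A g.1 g.2 * x := by
  simp [slotEnd]

theorem slotEnd_of_lt (A : GCM I) {g : I × ℤ} {r : ℤ} (h : g.2 < r) (x : hA A) :
    slotEnd A g r x = hATwist A g x := by
  simp [slotEnd, h, h.ne']

theorem slotEnd_of_gt (A : GCM I) {g : I × ℤ} {r : ℤ} (h : r < g.2) (x : hA A) :
    slotEnd A g r x = x := by
  simp [slotEnd, h.ne, h.not_gt]

theorem slot_mul_comm (A : GCM I) {g h : I × ℤ} (hle : g.2 ≤ h.2) {r : ℤ} (hr : r ≠ h.2) :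
    slot A g r * slot A h r = slot A h r * slot A g r := by
  ext x
  simp only [Module.End.mul_apply, coe_slot]
  rcases hr.lt_or_gt with hr | hr
  · rw [slotEnd_of_gt A hr, slotEnd_of_gt A hr]
  · simp only [slotEnd_of_lt A hr, slotEnd_of_lt A (hle.trans_lt hr)]
    exact hATwist_hATwist A g h x

theorem slot_mul_slot (A : GCM I) {g h : I × ℤ} (hlt : g.2 < h.2) :
    slot A g h.2 * slot A h h.2 = qh ^ commExp A g h • (slot A h h.2 * slot A g h.2) := by
  ext x
  simp only [Module.End.mul_apply, coe_slot, LinearMap.smul_apply, Submodule.coe_smul,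
    slotEnd_self, slotEnd_of_lt A hlt, map_mul, hATwist_ff, twistExp_of_lt A hlt, smul_mul_assoc]

theorem serrePoly_slot (A : GCM I) {i j : I} (p : ℤ) (h : i ≠ j) :
    serrePoly (qd A i) ((1 - A.c i j).toNat) (slot A (i, p) p) (slot A (j, p) p) = 0 := by
  have hs (k : I) (x : levelSpace A p) : (slot A (k, p) p x : hA A) = ff A k p * x :=
    slotEnd_self A (k, p) x
  have hpow (k : I) (n : ℕ) (x : levelSpace A p) :
      ((slot A (k, p) p ^ n) x : hA A) = ff A k p ^ n * x := by
    induction n with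
    | zero => simp
    | succ n ih => rw [pow_succ', Module.End.mul_apply, hs, ih, ← mul_assoc, ← pow_succ']
  ext x
  rw [LinearMap.zero_apply, Submodule.coe_zero, ← zero_mul (x : hA A), ← serrePoly_ff A p h,
    serrePoly, serrePoly, LinearMap.sum_apply, Finset.sum_mul, Submodule.coe_sum]
  refine Finset.sum_congr rfl fun n _ => ?_
  rw [LinearMap.smul_apply, Submodule.coe_smul, Module.End.mul_apply, Module.End.mul_apply, hpow,
    hs, hpow, smul_mul_assoc, mul_assoc, mul_assoc]

end Bosonic

section TensorOperators

variable {ι : Type} [DecidableEq ι] {M : ι → Type} [∀ k, AddCommMonoid (M k)]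
  [∀ k, Module 𝕂 (M k)]

theorem PiTensorProduct.map_mul_map_eq_smul (f g : ∀ k, Module.End 𝕂 (M k)) (k₀ : ι) (r : 𝕂)
    (h₀ : f k₀ * g k₀ = r • (g k₀ * f k₀)) (h : ∀ k, k ≠ k₀ → f k * g k = g k * f k) :
    PiTensorProduct.map f * PiTensorProduct.map g =
      r • (PiTensorProduct.map g * PiTensorProduct.map f) := by
  rw [← PiTensorProduct.map_mul, ← PiTensorProduct.map_mul]
  have e : (fun k => f k * g k) =
      Function.update (fun k => g k * f k) k₀ (r • (g k₀ * f k₀)) := by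
    funext k
    by_cases hk : k = k₀
    · subst hk
      rw [Function.update_self, h₀]
    · rw [Function.update_of_ne hk, h k hk]
  rw [e, PiTensorProduct.map_update_smul, Function.update_eq_self k₀ fun k => g k * f k]

theorem PiTensorProduct.serrePoly_map (t : 𝕂) (n : ℕ) (f g : ∀ k, Module.End 𝕂 (M k)) (k₀ : ι)
    (h₀ : serrePoly t n (f k₀) (g k₀) = 0) (h : ∀ k, k ≠ k₀ → f k * g k = g k * f k) :
    serrePoly t n (PiTensorProduct.map f) (PiTensorProduct.map g) = 0 := by
  set w : ∀ k, Module.End 𝕂 (M k) := fun k => f k ^ n * g k with hw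
  have e (k : ℕ) (hk : k ∈ Finset.range (n + 1)) :
      PiTensorProduct.map f ^ k * PiTensorProduct.map g * PiTensorProduct.map f ^ (n - k) =
        PiTensorProduct.map (Function.update w k₀ (f k₀ ^ k * g k₀ * f k₀ ^ (n - k))) := by
    rw [← PiTensorProduct.map_pow, ← PiTensorProduct.map_pow, ← PiTensorProduct.map_mul,
      ← PiTensorProduct.map_mul]
    congr 1
    funext l
    by_cases hl : l = k₀
    · subst hl
      simp
    · have hc : Commute (f l) (g l) := h l hl
      rw [Function.update_of_ne hl, hw, Pi.pow_apply, Pi.pow_apply, mul_assoc,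
        ← (hc.pow_left (n - k)).eq, ← mul_assoc, ← pow_add,
        Nat.add_sub_cancel' (Nat.lt_succ_iff.mp (Finset.mem_range.mp hk))]
  calc serrePoly t n (PiTensorProduct.map f) (PiTensorProduct.map g)
      = PiTensorProduct.mapMultilinear 𝕂 M M
          (Function.update w k₀ (serrePoly t n (f k₀) (g k₀))) := by
        rw [serrePoly, serrePoly, MultilinearMap.map_update_sum]
        refine Finset.sum_congr rfl fun k hk => ?_
        rw [e k hk, MultilinearMap.map_update_smul]
        rfl
    _ = 0 := by rw [h₀, MultilinearMap.map_update_zero]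

end TensorOperators

section Injectivity

/-- The tensor product `Â[b] ⊗ Â[b-1] ⊗ ⋯ ⊗ Â[a]`. -/
abbrev TensorSpace (A : GCM I) (a b : ℤ) : Type :=
  PiTensorProduct 𝕂 fun k : Fin (b + 1 - a).toNat => ↥(levelSpace A (b - (k : ℕ)))

/-- The operator on the tensor product by which the generator `g` of `QAlg A` acts. -/
def tensorOp (A : GCM I) (a b : ℤ) (g : I × ℤ) : Module.End 𝕂 (TensorSpace A a b) :=
  if a ≤ g.2 ∧ g.2 ≤ b then
    PiTensorProduct.map fun k : Fin (b + 1 - a).toNat => slot A g (b - (k : ℕ))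
  else 0

theorem exists_level_eq {a b p : ℤ} (hp : a ≤ p ∧ p ≤ b) :
    ∃ k₀ : Fin (b + 1 - a).toNat, b - (k₀ : ℕ) = p ∧ ∀ k, k ≠ k₀ → b - (k : ℕ) ≠ p := by
  refine ⟨⟨(b - p).toNat, by omega⟩, by simp only; omega, fun k hk e => hk ?_⟩
  ext
  simp only
  omega

theorem serrePoly_tensorOp (A : GCM I) (a b : ℤ) {i j : I} (p : ℤ) (h : i ≠ j) :
    serrePoly (qd A i) ((1 - A.c i j).toNat) (tensorOp A a b (i, p)) (tensorOp A a b (j, p)) =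
      0 := by
  by_cases hp : a ≤ p ∧ p ≤ b
  · rw [tensorOp, tensorOp, if_pos hp, if_pos hp]
    obtain ⟨k₀, rfl, hk⟩ := exists_level_eq hp
    exact PiTensorProduct.serrePoly_map _ _ _ _ k₀ (serrePoly_slot A _ h)
      fun k hne => slot_mul_comm A (le_refl (b - (k₀ : ℕ))) (hk k hne)
  · rw [tensorOp, tensorOp, if_neg hp, if_neg hp]
    simp [serrePoly]

theorem tensorOp_mul_tensorOp (A : GCM I) (a b : ℤ) {g h : I × ℤ} (hlt : g.2 < h.2) :
    tensorOp A a b g * tensorOp A a b h =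
      qh ^ commExp A g h • (tensorOp A a b h * tensorOp A a b g) := by
  by_cases hg : a ≤ g.2 ∧ g.2 ≤ b
  · by_cases hh : a ≤ h.2 ∧ h.2 ≤ b
    · rw [tensorOp, tensorOp, if_pos hg, if_pos hh]
      obtain ⟨k₀, hk₀, hk⟩ := exists_level_eq hh
      refine PiTensorProduct.map_mul_map_eq_smul _ _ k₀ _ ?_
        fun k hne => slot_mul_comm A hlt.le (hk k hne)
      rw [hk₀]
      exact slot_mul_slot A hlt
    · simp [tensorOp, hh]
  · simp [tensorOp, hg]

/-- The representation of `QAlg A` on the tensor product. -/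
def tensorRep (A : GCM I) (a b : ℤ) : QAlg A →ₐ[𝕂] Module.End 𝕂 (TensorSpace A a b) :=
  QAlg.lift A (tensorOp A a b) (fun _ _ p h => serrePoly_tensorOp A a b p h)
    fun _ _ h => tensorOp_mul_tensorOp A a b h

/-- The image of `1` under the action of the bosonic extension on `QAlg A`. -/
def vacuumMap (A : GCM I) : hA A →ₗ[𝕂] QAlg A :=
  LinearMap.applyₗ 1 ∘ₗ (hARep A).toLinearMap

theorem vacuumMap_apply (A : GCM I) (x : hA A) : vacuumMap A x = hARep A x 1 := rfl

theorem vacuumMap_one (A : GCM I) : vacuumMap A 1 = 1 := by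
  simp [vacuumMap_apply]

theorem vacuumMap_mul (A : GCM I) (x y : hA A) :
    vacuumMap A (x * y) = hARep A x (vacuumMap A y) := by
  simp [vacuumMap_apply]

theorem hARep_ff (A : GCM I) (i : I) (p : ℤ) : hARep A (ff A i p) = QAlg.op A (i, p) :=
  hALift_ff ..

theorem vacuumMap_ff (A : GCM I) (i : I) (p : ℤ) :
    vacuumMap A (ff A i p) = QAlg.gen A (i, p) := by
  rw [vacuumMap_apply, hARep_ff, QAlg.op_apply, QAlg.deriv_one, mul_one, add_zero]

/-- The common kernel of the derivations of level at least `r`. -/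
def derivKer (A : GCM I) (r : ℤ) : Submodule 𝕂 (QAlg A) :=
  ⨅ (g : I × ℤ) (_ : r ≤ g.2), LinearMap.ker (QAlg.deriv A g)

theorem mem_derivKer {A : GCM I} {r : ℤ} {u : QAlg A} :
    u ∈ derivKer A r ↔ ∀ g : I × ℤ, r ≤ g.2 → QAlg.deriv A g u = 0 := by
  simp [derivKer, Submodule.mem_iInf]

theorem one_mem_derivKer (A : GCM I) (r : ℤ) : 1 ∈ derivKer A r :=
  mem_derivKer.mpr fun g _ => QAlg.deriv_one A g

theorem derivKer_mono (A : GCM I) {r s : ℤ} (h : r ≤ s) : derivKer A r ≤ derivKer A s :=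
  fun _ hu => mem_derivKer.mpr fun g hg => mem_derivKer.mp hu g (h.trans hg)

theorem hAk_induction {A : GCM I} {r : ℤ} {P : ∀ x : hA A, x ∈ hAk A r → Prop}
    (hff : ∀ i, P (ff A i r) (ff_mem_hAk A i r))
    (hconst : ∀ c, P (algebraMap 𝕂 _ c) (Subalgebra.algebraMap_mem _ c))
    (hadd : ∀ x y hx hy, P x hx → P y hy → P (x + y) (add_mem hx hy))
    (hmul : ∀ x y hx hy, P x hx → P y hy → P (x * y) (mul_mem hx hy)) {x : hA A}
    (hx : x ∈ hAk A r) : P x hx := by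
  refine Algebra.adjoin_induction ?_ hconst hadd hmul hx
  rintro _ ⟨i, k, h1, h2, rfl⟩
  obtain rfl := le_antisymm h1 h2
  exact hff i

theorem hARep_apply_of_mem (A : GCM I) {r : ℤ} {x : hA A} (hx : x ∈ hAk A r) :
    ∀ u ∈ derivKer A r, hARep A x u = vacuumMap A x * u ∧ hARep A x u ∈ derivKer A r := by
  induction hx using hAk_induction with
  | hff i =>
    intro u hu
    rw [hARep_ff, vacuumMap_ff, QAlg.op_apply, mem_derivKer.mp hu (i, r) le_rfl, add_zero]
    refine ⟨rfl, mem_derivKer.mpr fun g hg => ?_⟩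
    rw [QAlg.deriv_gen_mul, mem_derivKer.mp hu g hg, commConst_of_ne A (by simp only; omega)]
    simp
  | hconst c =>
    intro u hu
    rw [vacuumMap_apply, AlgHom.commutes, Module.algebraMap_end_apply, Module.algebraMap_end_apply,
      smul_one_mul]
    exact ⟨rfl, Submodule.smul_mem _ c hu⟩
  | hadd x y _ _ hx hy =>
    intro u hu
    rw [map_add, map_add, LinearMap.add_apply, add_mul, ← (hx u hu).1, ← (hy u hu).1]
    exact ⟨rfl, Submodule.add_mem _ (hx u hu).2 (hy u hu).2⟩
  | hmul x y _ _ hx hy =>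
    intro u hu
    have h1 := one_mem_derivKer A r
    rw [vacuumMap_mul, map_mul, Module.End.mul_apply,
      (hx _ (show vacuumMap A y ∈ derivKer A r from (hy 1 h1).2)).1, mul_assoc, ← (hy u hu).1]
    exact hx _ (hy u hu).2

theorem tensorRep_tprod_update (A : GCM I) (a b : ℤ) (k₀ : Fin (b + 1 - a).toNat)
    (y : ∀ k : Fin (b + 1 - a).toNat, levelSpace A (b - (k : ℕ)))
    (hy : ∀ k, k < k₀ → y k = levelUnit A (b - (k : ℕ))) {x : hA A}
    (hx : x ∈ hAk A (b - (k₀ : ℕ))) :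
    ∀ z z' : levelSpace A (b - (k₀ : ℕ)), (z' : hA A) = x * z →
      tensorRep A a b (vacuumMap A x) (PiTensorProduct.tprod 𝕂 (Function.update y k₀ z)) =
        PiTensorProduct.tprod 𝕂 (Function.update y k₀ z') := by
  induction hx using hAk_induction with
  | hff i =>
    intro z z' hz
    have hk₀ := k₀.isLt
    rw [vacuumMap_ff, tensorRep, QAlg.lift_gen, tensorOp, if_pos ⟨by simp only; omega, by simp⟩,
      PiTensorProduct.map_tprod]
    congr 1
    funext k
    ext
    rw [coe_slot]
    rcases lt_trichotomy k k₀ with hk | rfl | hk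
    · rw [Function.update_of_ne hk.ne, Function.update_of_ne hk.ne, hy k hk,
        slotEnd_of_lt A (by simpa using hk)]
      exact map_one _
    · rw [Function.update_self, Function.update_self, hz]
      exact slotEnd_self A (i, _) _
    · rw [Function.update_of_ne hk.ne', Function.update_of_ne hk.ne',
        slotEnd_of_gt A (by simpa using hk)]
  | hconst c =>
    intro z z' hz
    have e : z' = c • z := by
      ext
      rw [hz, Submodule.coe_smul, Algebra.smul_def]
    rw [e, MultilinearMap.map_update_smul, vacuumMap_apply, AlgHom.commutes,
      Module.algebraMap_end_apply, map_smul, map_one, LinearMap.smul_apply, Module.End.one_apply]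
  | hadd x y hx hy ihx ihy =>
    intro z z' hz
    set u : levelSpace A (b - (k₀ : ℕ)) := ⟨x * z, (hAk A _).mul_mem hx z.2⟩ with hu
    set v : levelSpace A (b - (k₀ : ℕ)) := ⟨y * z, (hAk A _).mul_mem hy z.2⟩ with hv
    have e : z' = u + v := by
      ext
      rw [hz, add_mul]
      rfl
    rw [e, MultilinearMap.map_update_add, map_add, map_add, LinearMap.add_apply, ihx z u rfl,
      ihy z v rfl]
  | hmul x y hx hy ihx ihy =>
    intro z z' hz
    have h := hARep_apply_of_mem A hx (vacuumMap A y)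
      (hARep_apply_of_mem A hy 1 (one_mem_derivKer A _)).2
    rw [vacuumMap_mul, h.1, map_mul, Module.End.mul_apply,
      ihy z ⟨y * z, (hAk A _).mul_mem hy z.2⟩ rfl]
    exact ihx _ _ (by rw [hz, mul_assoc])

/-- The tensor of units. -/
def unitTensor (A : GCM I) (a b : ℤ) : TensorSpace A a b :=
  PiTensorProduct.tprod 𝕂 fun k => levelUnit A (b - (k : ℕ))

theorem mulMap_tprod (A : GCM I) (a b : ℤ)
    (x : ∀ k : Fin (b + 1 - a).toNat, levelSpace A (b - (k : ℕ))) :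
    mulMap A a b (PiTensorProduct.tprod 𝕂 x) = (List.ofFn fun k => (x k : hA A)).prod := by
  rw [mulMap, PiTensorProduct.lift.tprod]
  simp

theorem tensorRep_vacuumMap_drop (A : GCM I) (a b : ℤ)
    (x : ∀ k : Fin (b + 1 - a).toNat, levelSpace A (b - (k : ℕ))) (m : ℕ) :
    ∀ j : ℕ, j + m = (b + 1 - a).toNat →
      vacuumMap A ((List.ofFn fun k => (x k : hA A)).drop j).prod ∈ derivKer A (b - j) ∧
      tensorRep A a b (vacuumMap A ((List.ofFn fun k => (x k : hA A)).drop j).prod)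
          (unitTensor A a b) =
        PiTensorProduct.tprod 𝕂 fun k : Fin (b + 1 - a).toNat =>
          if (k : ℕ) < j then levelUnit A (b - (k : ℕ)) else x k := by
  induction m with
  | zero =>
    intro j hj
    rw [List.drop_of_length_le (by simp; omega), List.prod_nil, vacuumMap_one, map_one,
      Module.End.one_apply, unitTensor]
    refine ⟨one_mem_derivKer A _, ?_⟩
    congr 1
    funext k
    rw [if_pos (by omega)]
  | succ m ih =>
    intro j hj
    obtain ⟨h1, h2⟩ := ih (j + 1) (by omega)
    set k₀ : Fin (b + 1 - a).toNat := ⟨j, by omega⟩ with hk₀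
    have hmem : (x k₀ : hA A) ∈ hAk A (b - j) := (x k₀).2
    obtain ⟨h3, h4⟩ := hARep_apply_of_mem A hmem _ (derivKer_mono A (by push_cast; omega) h1)
    rw [List.drop_eq_getElem_cons (by simp; omega), List.prod_cons, List.getElem_ofFn,
      vacuumMap_mul]
    refine ⟨h4, ?_⟩
    rw [h3, map_mul, Module.End.mul_apply, h2]
    set y : ∀ k : Fin (b + 1 - a).toNat, levelSpace A (b - (k : ℕ)) :=
      fun k => if (k : ℕ) < j + 1 then levelUnit A (b - (k : ℕ)) else x k with hy
    have e1 : Function.update y k₀ (levelUnit A (b - (k₀ : ℕ))) = y := by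
      rw [Function.update_eq_self_iff, hy]
      simp [hk₀]
    have h5 := tensorRep_tprod_update A a b k₀ y (fun k hk => if_pos (Nat.lt_succ_of_lt hk)) hmem
      (levelUnit A (b - (k₀ : ℕ))) (x k₀) (by simp [levelUnit])
    rw [e1] at h5
    rw [h5]
    congr 1
    funext k
    rcases eq_or_ne k k₀ with rfl | hk
    · rw [Function.update_self, if_neg (by simp [hk₀])]
    · have hne : (k : ℕ) ≠ j := fun e => hk (Fin.ext e)
      rw [Function.update_of_ne hk, hy]
      simp only [show (k : ℕ) < j + 1 ↔ (k : ℕ) < j by omega]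

theorem mulMap_injective (A : GCM I) (a b : ℤ) : Function.Injective (mulMap A a b) := by
  have h : (LinearMap.applyₗ (unitTensor A a b) ∘ₗ (tensorRep A a b).toLinearMap ∘ₗ
      vacuumMap A) ∘ₗ mulMap A a b = LinearMap.id := by
    refine PiTensorProduct.ext (MultilinearMap.ext fun x => ?_)
    have h := (tensorRep_vacuumMap_drop A a b x _ 0 (zero_add _)).2
    simpa [mulMap_tprod] using h
  refine Function.LeftInverse.injective (g := fun x => tensorRep A a b (vacuumMap A x)
    (unitTensor A a b)) fun x => ?_
  exact LinearMap.congr_fun h x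

end Injectivity

section Range

theorem ff_mul_of_mem_hAk (A : GCM I) (i : I) {p r : ℤ} (hpr : p < r) {x : hA A}
    (hx : x ∈ hAk A r) :
    ∃ y ∈ hAk A r, ∃ z ∈ hAk A r, ff A i p * x = y * ff A i p + z := by
  induction hx using hAk_induction with
  | hff j =>
    refine ⟨_, (hAk A r).smul_mem (ff_mem_hAk A j r) (qh ^ commExp A (i, p) (j, r)), _,
      (hAk A r).smul_mem (hAk A r).one_mem (commConst A (i, p) (j, r)), ?_⟩
    rw [smul_mul_assoc]
    exact ff_mul_ff A (g := (i, p)) (h := (j, r)) hpr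
  | hconst c =>
    refine ⟨_, Subalgebra.algebraMap_mem _ c, 0, Subalgebra.zero_mem _, ?_⟩
    rw [add_zero, Algebra.commutes]
  | hadd x x' _ _ h h' =>
    obtain ⟨y, hy, z, hz, e⟩ := h
    obtain ⟨y', hy', z', hz', e'⟩ := h'
    refine ⟨_, add_mem hy hy', _, add_mem hz hz', ?_⟩
    rw [mul_add, e, e', add_mul]
    abel
  | hmul x x' _ hx' h h' =>
    obtain ⟨y, hy, z, hz, e⟩ := h
    obtain ⟨y', hy', z', hz', e'⟩ := h'
    refine ⟨_, mul_mem hy hy', _, add_mem (mul_mem hy hz') (mul_mem hz hx'), ?_⟩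
    rw [← mul_assoc, e, add_mul, mul_assoc, e', mul_add, mul_assoc, add_assoc]

theorem Submodule.prod_ofFn_le_span {R S : Type} [CommSemiring R] [Semiring S] [Algebra R S]
    {n : ℕ} (B : Fin n → Submodule R S) :
    (List.ofFn B).prod ≤
      Submodule.span R {y | ∃ x : ∀ k, B k, y = (List.ofFn fun k => (x k : S)).prod} := by
  induction n with
  | zero =>
    rw [List.ofFn_zero, List.prod_nil, Submodule.one_eq_span]
    exact Submodule.span_mono (by rintro _ rfl; exact ⟨fun k => 0, by simp⟩)
  | succ n ih =>
    rw [List.ofFn_succ, List.prod_cons, Submodule.mul_le]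
    intro u hu v hv
    refine (Submodule.span_le (p := (Submodule.span R _).comap (LinearMap.mulLeft R u))).mpr ?_
      (ih _ hv)
    rintro _ ⟨x, rfl⟩
    exact Submodule.subset_span ⟨Fin.cons ⟨u, hu⟩ x, by simp [List.ofFn_succ]⟩

theorem prod_drop_levelSpace (A : GCM I) (a b : ℤ) (m : ℕ) :
    ∀ j : ℕ, j + m = (b + 1 - a).toNat →
      1 ∈ ((List.ofFn fun k : Fin (b + 1 - a).toNat =>
        levelSpace A (b - (k : ℕ))).drop j).prod ∧
      ∀ i p, a ≤ p → p ≤ b - j →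
        ∀ v ∈ ((List.ofFn fun k : Fin (b + 1 - a).toNat =>
          levelSpace A (b - (k : ℕ))).drop j).prod,
        ff A i p * v ∈ ((List.ofFn fun k : Fin (b + 1 - a).toNat =>
          levelSpace A (b - (k : ℕ))).drop j).prod := by
  induction m with
  | zero =>
    intro j hj
    rw [List.drop_of_length_le (by simp; omega), List.prod_nil]
    exact ⟨Submodule.one_le.mp le_rfl, fun i p h1 h2 => by omega⟩
  | succ m ih =>
    intro j hj
    obtain ⟨h1, h2⟩ := ih (j + 1) (by omega)
    rw [List.drop_eq_getElem_cons (by simp; omega), List.prod_cons, List.getElem_ofFn]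
    refine ⟨by simpa using Submodule.mul_mem_mul (hAk A (b - j)).one_mem h1, ?_⟩
    intro i p hap hpj v hv
    induction hv using Submodule.mul_induction_on' with
    | mem_mul_mem x hx w hw =>
      rcases hpj.lt_or_eq with hlt | rfl
      · obtain ⟨y, hy, z, hz, e⟩ := ff_mul_of_mem_hAk A i hlt hx
        rw [← mul_assoc, e, add_mul, mul_assoc]
        exact add_mem (Submodule.mul_mem_mul hy (h2 i p hap (by push_cast; omega) w hw))
          (Submodule.mul_mem_mul hz hw)
      · rw [← mul_assoc]
        exact Submodule.mul_mem_mul ((hAk A _).mul_mem (ff_mem_hAk A i _) hx) hw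
    | add x _ y _ hx hy =>
      rw [mul_add]
      exact add_mem hx hy

theorem range_mulMap (A : GCM I) (a b : ℤ) :
    LinearMap.range (mulMap A a b) = Subalgebra.toSubmodule (hAband A a b) := by
  apply le_antisymm
  · rintro _ ⟨t, rfl⟩
    induction t using PiTensorProduct.induction_on with
    | smul_tprod c x =>
      rw [map_smul, mulMap_tprod]
      refine Submodule.smul_mem _ c (list_prod_mem (S := hAband A a b) fun y hy => ?_)
      obtain ⟨k, rfl⟩ := List.mem_ofFn.mp hy
      refine Algebra.adjoin_mono ?_ (x k).2
      rintro _ ⟨i, l, h1, h2, rfl⟩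
      exact ⟨i, l, by omega, by omega, rfl⟩
    | add t s ht hs =>
      rw [map_add]
      exact add_mem ht hs
  · obtain ⟨h1, h2⟩ := prod_drop_levelSpace A a b _ 0 (zero_add _)
    rw [List.drop_zero] at h1 h2
    have key (x : hA A) (hx : x ∈ hAband A a b) :
        ∀ v ∈ (List.ofFn fun k : Fin (b + 1 - a).toNat => levelSpace A (b - (k : ℕ))).prod,
          x * v ∈ (List.ofFn fun k : Fin (b + 1 - a).toNat => levelSpace A (b - (k : ℕ))).prod := by
      induction hx using Algebra.adjoin_induction with
      | mem x hx =>
        obtain ⟨i, p, hap, hpb, rfl⟩ := hx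
        exact h2 i p hap (by simpa using hpb)
      | algebraMap c =>
        intro v hv
        rw [← Algebra.smul_def]
        exact Submodule.smul_mem _ c hv
      | add x y _ _ hx hy =>
        intro v hv
        rw [add_mul]
        exact add_mem (hx v hv) (hy v hv)
      | mul x y _ _ hx hy =>
        intro v hv
        rw [mul_assoc]
        exact hx _ (hy v hv)
    intro x hx
    have hx' := key x hx 1 h1
    rw [mul_one] at hx'
    refine Submodule.span_le.mpr ?_ (Submodule.prod_ofFn_le_span _ hx')
    rintro _ ⟨y, rfl⟩
    exact ⟨PiTensorProduct.tprod 𝕂 y, mulMap_tprod A a b y⟩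

end Range

/-- for `a ≤ b`, the multiplication map
`Â[b] ⊗ Â[b-1] ⊗ ⋯ ⊗ Â[a+1] ⊗ Â[a] → Â[a,b]` is an isomorphism of vector spaces
(injective with range exactly `Â[a,b]`). -/
theorem statement7 (A : GCM I) (a b : ℤ) (hab : a ≤ b) :
    Function.Injective (mulMap A a b) ∧
      LinearMap.range (mulMap A a b) = Subalgebra.toSubmodule (hAband A a b) :=
  ⟨mulMap_injective A a b, range_mulMap A a b⟩

end
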